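/- Let q_M > 0 and μ_M > 0 be real constants, and let u, u', U, U', d, a, R be nonnegative real numbers satisfying u' ≤ [u − d]^+ + a, U' ≤ U + R, u' ≤ q_M, and R ≤ μ_M. Then (1/q_M)·(u'²·U' − u²·U) ≤ μ_M·q_M + (U/q_M)·(d² + a² − 2·u·(d − a)). -/

import Mathlib

/-- Core of the paper's inequalities (20)–(21): per-node, per-flow drift bound
for the cross term `(1/q_M)·u²·U`, where `u' ≤ [u − d]⁺ + a`, `u' ≤ q_M`,
`U' ≤ U + R` and `R ≤ μ_M`. -/
theorem stmt_11 (qM μM : ℝ) (hqM : 0 < qM) (hμM : 0 < μM)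
    (u u' U U' d a R : ℝ)
    (hu : 0 ≤ u) (hu' : 0 ≤ u') (hU : 0 ≤ U) (hU' : 0 ≤ U')
    (hd : 0 ≤ d) (ha : 0 ≤ a) (hR : 0 ≤ R)
    (hdyn : u' ≤ max (u - d) 0 + a) (hvq : U' ≤ U + R)
    (hub : u' ≤ qM) (hRb : R ≤ μM) :
    (1 / qM) * (u' ^ 2 * U' - u ^ 2 * U) ≤
      μM * qM + (U / qM) * (d ^ 2 + a ^ 2 - 2 * u * (d - a)) := by
  have hsq : u' ^ 2 ≤ u ^ 2 + (d ^ 2 + a ^ 2 - 2 * u * (d - a)) := by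
    rcases max_cases (u - d) 0 with ⟨h, h0⟩ | ⟨h, h0⟩ <;> rw [h] at hdyn
    · have := pow_le_pow_left₀ hu' hdyn 2
      nlinarith [mul_nonneg ha hd]
    · have := pow_le_pow_left₀ hu' hdyn 2
      nlinarith [mul_nonneg hu ha, sq_nonneg (u - d)]
  have hvirtual : u' ^ 2 * U' ≤ u' ^ 2 * U + qM ^ 2 * μM := by
    have h₁ : u' ^ 2 * U' ≤ u' ^ 2 * (U + μM) := by gcongr; linarith
    have h₂ : u' ^ 2 * μM ≤ qM ^ 2 * μM := by gcongr
    linarith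
  have hactual := mul_le_mul_of_nonneg_right hsq hU
  calc (1 / qM) * (u' ^ 2 * U' - u ^ 2 * U)
      ≤ (1 / qM) * (qM ^ 2 * μM + U * (d ^ 2 + a ^ 2 - 2 * u * (d - a))) := by
        gcongr
        linarith
    _ = μM * qM + (U / qM) * (d ^ 2 + a ^ 2 - 2 * u * (d - a)) := by
        field_simp
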